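/- Let h = 2n+1 be an odd integer with n ≥ 1, let 0 ≤ i ≤ n, let σ be an h-bar-core with exactly k ≥ 1 addable i-nodes and let τ = ψ_i(σ), so that P_{σ,2} and P_{τ,2} form a [2:k]-pair of residue i; assume either i ≥ 1 or k ≥ 3. If λ ∈ P_{σ,2} has no removable i-node, then λ has a part equal to h or to 2h if and only if ψ_i(λ) has a part equal to h or to 2h. -/

import Mathlib

/-- A partition: a weakly decreasing sequence of non-negative integers with
finite sum (finitely many nonzero parts), indexed from 0 (so `parts 0` is λ₁). -/
structure BPartition where
  parts : ℕ →₀ ℕ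
  antitone : ∀ r, parts (r + 1) ≤ parts r

namespace BPartition

/-- The multiset of positive parts of a partition. -/
def partsM (lam : BPartition) : Multiset ℕ :=
  lam.parts.support.val.map (fun r => lam.parts r)

/-- The Young diagram: nodes `(r, c)` with rows indexed from 0 and columns from 1. -/
def diagram (lam : BPartition) : Set (ℕ × ℕ) :=
  {x | 1 ≤ x.2 ∧ x.2 ≤ lam.parts x.1}

/-- A partition is strict if λ_r > λ_{r+1} whenever λ_r > 0. -/
def IsStrict (lam : BPartition) : Prop :=
  ∀ r, 0 < lam.parts r → lam.parts (r + 1) < lam.parts r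

/-- A partition is h-strict if each part is either strictly bigger than the next,
or positive and divisible by h, or zero. -/
def IsHStrict (h : ℕ) (lam : BPartition) : Prop :=
  ∀ r, lam.parts (r + 1) < lam.parts r ∨ (0 < lam.parts r ∧ h ∣ lam.parts r) ∨ lam.parts r = 0

/-- An h-strict partition is restricted if for every r either λ_{r+1} > λ_r − h,
or λ_{r+1} = λ_r − h and h does not divide λ_r. -/
def IsRestricted (h : ℕ) (lam : BPartition) : Prop :=
  ∀ r, lam.parts r < lam.parts (r + 1) + h ∨
    (lam.parts (r + 1) + h = lam.parts r ∧ ¬ h ∣ lam.parts r)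

/-- The residue of a node in column c (1-indexed): the smaller of the residues of
c − 1 and of −c modulo h. -/
def colRes (h c : ℕ) : ℕ := min ((c - 1) % h) ((h - c % h) % h)

/-- `x` is an addable i-node of `lam`. -/
def Addable (h i : ℕ) (lam : BPartition) (x : ℕ × ℕ) : Prop :=
  colRes h x.2 = i ∧ x ∉ diagram lam ∧
  ∃ nu : BPartition, IsHStrict h nu ∧ diagram lam ⊆ diagram nu ∧ x ∈ diagram nu ∧
    ∀ y ∈ diagram nu, y ∉ diagram lam → colRes h y.2 = i

/-- `x` is a removable i-node of `lam`. -/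
def Removable (h i : ℕ) (lam : BPartition) (x : ℕ × ℕ) : Prop :=
  x ∈ diagram lam ∧
  ∃ mu : BPartition, IsHStrict h mu ∧ diagram mu ⊆ diagram lam ∧ x ∉ diagram mu ∧
    ∀ y ∈ diagram lam, y ∉ diagram mu → colRes h y.2 = i

/-- Removal of a single h-bar from `lam` giving `mu`, recording the value `v`:
either a part `v ≥ h` is replaced by `v − h` (deleted if `v = h`), or two parts
summing to `h` are deleted, in which case `v` is the larger of the two. -/
def barStepRec (h : ℕ) (lam mu : BPartition) (v : ℕ) : Prop :=
  IsHStrict h mu ∧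
  ((v = h ∧ v ∈ partsM lam ∧ partsM mu = (partsM lam).erase v) ∨
   (h < v ∧ v ∈ partsM lam ∧ partsM mu = (v - h) ::ₘ (partsM lam).erase v) ∨
   (∃ a b : ℕ, a + b = h ∧ a ∈ partsM lam ∧ b ∈ (partsM lam).erase a ∧
      v = max a b ∧ partsM mu = ((partsM lam).erase a).erase b))

/-- Removal of a single h-bar. -/
def barStep (h : ℕ) (lam mu : BPartition) : Prop :=
  ∃ v, barStepRec h lam mu v

/-- An h-bar-core: an h-strict partition from which no h-bar can be removed. -/
def IsBarCore (h : ℕ) (lam : BPartition) : Prop :=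
  IsHStrict h lam ∧ ∀ mu, ¬ barStep h lam mu

/-- A chain of `w` h-bar removals from `lam` down to `mu`. -/
def barChain (h : ℕ) : ℕ → BPartition → BPartition → Prop
  | 0, lam, mu => lam = mu
  | w + 1, lam, mu => ∃ nu, barStep h lam nu ∧ barChain h w nu mu

/-- `lam ∈ P_{τ,w}`: `lam` is h-strict with h-bar-core `tau` and h-bar-weight `w`. -/
def InBlock (h : ℕ) (tau : BPartition) (w : ℕ) (lam : BPartition) : Prop :=
  IsHStrict h lam ∧ IsBarCore h tau ∧ barChain h w lam tau

/-- The left-to-right order on node positions along the edge of a Young diagram: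
smaller column first; within a column, larger row first. -/
def posLE (x y : ℕ × ℕ) : Prop := x.2 < y.2 ∨ (x.2 = y.2 ∧ y.1 ≤ x.1)

/-- `x` is a normal i-node: a removable i-node surviving (as a − sign) in the
reduced i-signature; equivalently, every window of the i-signature ending at `x`
contains strictly more removable than addable i-nodes. -/
def Normal (h i : ℕ) (lam : BPartition) (x : ℕ × ℕ) : Prop :=
  Removable h i lam x ∧ ∀ z : ℕ × ℕ, posLE z x →
    Set.ncard {y | Addable h i lam y ∧ posLE z y ∧ posLE y x} <
      Set.ncard {y | Removable h i lam y ∧ posLE z y ∧ posLE y x}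

/-- `x` is a conormal i-node: an addable i-node surviving (as a + sign) in the
reduced i-signature. -/
def Conormal (h i : ℕ) (lam : BPartition) (x : ℕ × ℕ) : Prop :=
  Addable h i lam x ∧ ∀ z : ℕ × ℕ, posLE x z →
    Set.ncard {y | Removable h i lam y ∧ posLE x y ∧ posLE y z} <
      Set.ncard {y | Addable h i lam y ∧ posLE x y ∧ posLE y z}

/-- The node set of ψ_i(λ): add the leftmost s − r conormal i-nodes if s ≥ r,
remove the rightmost r − s normal i-nodes if r > s, where r = #normal and
s = #conormal i-nodes. -/
noncomputable def psiSet (h i : ℕ) (lam : BPartition) : Set (ℕ × ℕ) :=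
  if Set.ncard {x | Normal h i lam x} ≤ Set.ncard {x | Conormal h i lam x} then
    diagram lam ∪ {x | Conormal h i lam x ∧
      Set.ncard {y | Conormal h i lam y ∧ posLE y x} ≤
        Set.ncard {x | Conormal h i lam x} - Set.ncard {x | Normal h i lam x}}
  else
    diagram lam \ {x | Normal h i lam x ∧
      Set.ncard {y | Normal h i lam y ∧ posLE x y} ≤
        Set.ncard {x | Normal h i lam x} - Set.ncard {x | Conormal h i lam x}}

open Classical in
/-- The involution ψ_i. -/
noncomputable def psi (h i : ℕ) (lam : BPartition) : BPartition :=
  if hex : ∃ mu : BPartition, diagram mu = psiSet h i lam then hex.choose else lam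

/-- The set of occupied positions of the abacus display of a strict partition. -/
def abacus (lam : BPartition) : Set ℤ :=
  {a | a = 0 ∨ (0 < a ∧ a.toNat ∈ partsM lam) ∨ (a < 0 ∧ (-a).toNat ∉ partsM lam)}

/-- The dominance order: λ ⊴ μ. -/
def domLE (lam mu : BPartition) : Prop :=
  ∀ r, ∑ s ∈ Finset.range r, lam.parts s ≤ ∑ s ∈ Finset.range r, mu.parts s

/-- Strict dominance: λ ◁ μ. -/
def domLT (lam mu : BPartition) : Prop := domLE lam mu ∧ lam ≠ mu

/-- Lexicographic order: λ <lex μ. -/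
def lexLT (lam mu : BPartition) : Prop :=
  ∃ r, lam.parts r < mu.parts r ∧ ∀ s < r, lam.parts s = mu.parts s

/-- Colexicographic order: λ <colex μ. -/
def colexLT (lam mu : BPartition) : Prop :=
  ∃ r, mu.parts r < lam.parts r ∧ ∀ s, r < s → lam.parts s = mu.parts s

/-- λ ↔ᵢ μ: every node of the symmetric difference of the diagrams has residue i. -/
def Link (h i : ℕ) (lam mu : BPartition) : Prop :=
  ∀ x : ℕ × ℕ, x ∈ (diagram lam \ diagram mu) ∪ (diagram mu \ diagram lam) →
    colRes h x.2 = i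

/-- `a ≤ b` are the bar positions of `lam ∈ P_{τ,2}`: the values recorded by
some two-step removal of h-bars from `lam` down to `tau`. -/
def BarPositions (h : ℕ) (tau lam : BPartition) (a b : ℕ) : Prop :=
  a ≤ b ∧ ∃ (nu : BPartition) (v₁ v₂ : ℕ), barStepRec h lam nu v₁ ∧ barStepRec h nu tau v₂ ∧
    ({a, b} : Multiset ℕ) = {v₁, v₂}

/-- The leg length of the bar of `lam ∈ P_{τ,2}` at bar position `c`. -/
noncomputable def legLen (h : ℕ) (tau lam : BPartition) (c : ℕ) : ℕ :=
  if h ≤ c then Set.ncard {x : ℕ | c - h < x ∧ x < c ∧ x ∈ partsM lam ∧ x ∈ partsM tau}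
  else (h - c) + Set.ncard {x : ℕ | h - c < x ∧ x < c ∧ x ∈ partsM lam ∧ x ∈ partsM tau}

/-- ∂λ: the absolute difference of the two leg lengths of `lam`, whose bar
positions are `a ≤ b`. -/
noncomputable def ddd (h : ℕ) (tau lam : BPartition) (a b : ℕ) : ℕ :=
  max (legLen h tau lam a) (legLen h tau lam b) - min (legLen h tau lam a) (legLen h tau lam b)

inductive Colour | black | white | grey
deriving DecidableEq

/-- β(τ): the number of parts of τ less than h. -/
def betaCount (h : ℕ) (tau : BPartition) : ℕ :=
  Multiset.card ((partsM tau).filter (fun x => x < h))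

/-- The leg length of a 2h-bar of `lam` with larger bar position `b`. -/
noncomputable def legLen2 (h : ℕ) (tau lam : BPartition) (b : ℕ) : ℕ :=
  if 2 * h ≤ b then Set.ncard {x : ℕ | b - 2 * h < x ∧ x < b ∧ x ∈ partsM lam ∧ x ∈ partsM tau}
  else (2 * h - b) + Set.ncard {x : ℕ | 2 * h - b < x ∧ x < b ∧ x ∈ partsM lam ∧ x ∈ partsM tau}

/-- The colour of `lam ∈ P_{τ,2}` with bar positions `a ≤ b`. -/
noncomputable def colour (h : ℕ) (tau lam : BPartition) (a b : ℕ) : Colour :=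
  if 2 ≤ ddd h tau lam a b then Colour.grey
  else if ddd h tau lam a b = 1 then
    if h < b then Colour.grey
    else if (min (legLen h tau lam a) (legLen h tau lam b) + betaCount h tau) % 2 = 1 then
      Colour.black else Colour.white
  else
    if b = a + h ∨ a + b = 2 * h then
      if (legLen2 h tau lam b + 2 * betaCount h tau) % 4 = 0 ∨
         (legLen2 h tau lam b + 2 * betaCount h tau) % 4 = 3 then Colour.black
      else Colour.white
    else
      if (legLen h tau lam a + betaCount h tau) % 2 = 1 then Colour.black else Colour.white

end BPartition

namespace BPartition

theorem aux_mem_partsM (lam : BPartition) (v : ℕ) (hv : 0 < v) :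
    v ∈ partsM lam ↔ ∃ r, lam.parts r = v := by
  unfold partsM
  simp only [Multiset.mem_map, Finset.mem_val, Finsupp.mem_support_iff]
  constructor
  · rintro ⟨r, _, h⟩; exact ⟨r, h⟩
  · rintro ⟨r, h⟩; exact ⟨r, by omega, h⟩

theorem aux_anti (lam : BPartition) : Antitone lam.parts :=
  antitone_nat_of_succ_le lam.antitone

theorem aux_update (lam : BPartition) (r v : ℕ) (h1 : lam.parts (r+1) ≤ v)
    (h2 : ∀ s, s + 1 = r → v ≤ lam.parts s) :
    ∃ nu : BPartition, ∀ s, nu.parts s = if s = r then v else lam.parts s := by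
  classical
  refine ⟨⟨lam.parts.update r v, ?_⟩, ?_⟩
  · intro s
    simp only [Finsupp.update_apply]
    have := lam.antitone s
    split_ifs with ha hb hb
    · exact le_rfl
    · exact h2 s ha
    · subst hb; exact h1
    · exact this
  · intro s; simp [Finsupp.update_apply]

theorem aux_res {h : ℕ} (hh : 3 ≤ h) {c : ℕ} (hc : 1 ≤ c) (hr : colRes h c = 0) :
    c % h = 0 ∨ (c - 1) % h = 0 := by
  unfold colRes at hr
  rcases Nat.min_eq_zero_iff.mp hr with h' | h'
  · exact Or.inr h'
  · left
    have := Nat.mod_lt c (show 0 < h by omega)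
    by_contra h0
    rw [Nat.mod_eq_of_lt (by omega)] at h'
    omega

theorem aux_res0 {h : ℕ} (j : ℕ) : colRes h (j * h) = 0 := by
  unfold colRes; simp

theorem aux_res1 {h : ℕ} (j : ℕ) : colRes h (j * h + 1) = 0 := by
  unfold colRes; simp

theorem aux_res2 {h : ℕ} (hh : 3 ≤ h) (j : ℕ) : colRes h (j * h + 2) ≠ 0 := by
  intro hr
  rcases aux_res hh (by omega) hr with h' | h'
  · rw [Nat.add_comm, Nat.add_mul_mod_self_right, Nat.mod_eq_of_lt (by omega)] at h'; omega
  · rw [show j * h + 2 - 1 = 1 + j * h by omega, Nat.add_mul_mod_self_right,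
      Nat.mod_eq_of_lt (by omega)] at h'
    omega

theorem aux_resm {h : ℕ} (hh : 3 ≤ h) (j : ℕ) (hj : 1 ≤ j) : colRes h (j * h - 1) ≠ 0 := by
  obtain ⟨t, rfl⟩ : ∃ t, j = t + 1 := ⟨j - 1, by omega⟩
  have e : (t + 1) * h = t * h + h := by ring
  intro hr
  rcases aux_res hh (by omega) hr with h' | h'
  · rw [show (t + 1) * h - 1 = (h - 1) + t * h by omega, Nat.add_mul_mod_self_right,
      Nat.mod_eq_of_lt (by omega)] at h'
    omega
  · rw [show (t + 1) * h - 1 - 1 = (h - 2) + t * h by omega, Nat.add_mul_mod_self_right,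
      Nat.mod_eq_of_lt (by omega)] at h'
    omega

theorem aux_finite {h : ℕ} (hh : 3 ≤ h) (lam : BPartition) :
    {x | Addable h 0 lam x}.Finite := by
  obtain ⟨B, hB⟩ : ∃ B, ∀ r, B ≤ r → lam.parts r = 0 := by
    refine ⟨lam.parts.support.sup id + 1, fun r hr => ?_⟩
    by_contra h0
    have : id r ≤ lam.parts.support.sup id :=
      Finset.le_sup (Finsupp.mem_support_iff.mpr h0)
    simp only [id] at this
    omega
  set M := (lam.parts 0) * h + 2
  apply ((Set.finite_Iio (B + 1)).prod (Set.finite_Iio M)).subset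
  rintro ⟨r, c⟩ ⟨h1, h2, nu, hs, hsub, hx, hall⟩
  simp only [diagram, Set.mem_setOf_eq] at *
  simp only [Set.mem_prod, Set.mem_Iio]
  constructor
  · by_contra hr
    obtain ⟨s, rfl⟩ : ∃ s, r = s + 1 := ⟨r - 1, by omega⟩
    have e : lam.parts s = 0 := hB s (by omega)
    have h3 : 2 ≤ nu.parts s := by
      rcases hs s with h' | ⟨h', h''⟩ | h'
      · omega
      · have := Nat.le_of_dvd h' h''; omega
      · have := nu.antitone s; omega
    have := hall (s, 2) ⟨by simp, h3⟩ (by simp [e])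
    exact aux_res2 hh 0 (by simpa using this)
  · by_contra hc
    have e : lam.parts r ≤ lam.parts 0 := aux_anti lam (Nat.zero_le r)
    have e2 : lam.parts 0 ≤ lam.parts 0 * h := Nat.le_mul_of_pos_right _ (by omega)
    refine aux_res2 hh (lam.parts 0) (hall (r, M) ⟨?_, ?_⟩ ?_) <;> simp only [M] at * <;> omega

theorem aux_main {h : ℕ} (hh : 3 ≤ h) (lam mu : BPartition) (hs : IsHStrict h lam)
    (hunex : ∀ x, ¬ Removable h 0 lam x)
    (hm1 : ∀ x, x ∈ diagram mu → x ∉ diagram lam → Addable h 0 lam x)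
    (hm2 : ∀ x, x ∈ diagram lam ∨ Addable h 0 lam x → x ∈ diagram mu) (j : ℕ) (hj : 1 ≤ j) :
    (∃ r, lam.parts r = j * h) ↔ ∃ r, mu.parts r = j * h := by
  have r0 := aux_res0 (h := h) j
  have r1 := aux_res1 (h := h) j
  have r2 := aux_res2 hh j
  have rm := aux_resm hh j hj
  have hp3 : 3 ≤ j * h := by nlinarith
  have hdvd : h ∣ j * h := Dvd.intro_left j rfl
  have hndm : ¬ h ∣ j * h - 1 := by
    intro hd
    have := (Nat.dvd_sub hdvd hd)
    rw [show j * h - (j * h - 1) = 1 by omega] at this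
    have := Nat.le_of_dvd one_pos this
    omega
  have hndp : ¬ h ∣ j * h + 1 := by
    intro hd
    have := (Nat.dvd_sub hd hdvd)
    rw [show j * h + 1 - j * h = 1 by omega] at this
    have := Nat.le_of_dvd one_pos this
    omega
  generalize j * h = p at *
  constructor
  · intro hex
    -- largest row with part p
    obtain ⟨r, hr, hlast⟩ : ∃ r, lam.parts r = p ∧ lam.parts (r + 1) < p := by
      by_contra hcon
      push Not at hcon
      obtain ⟨r, hr⟩ := hex
      have hall : ∀ s, lam.parts (r + s) = p := by
        intro s
        induction s with
        | zero => exact hr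
        | succ s ih =>
          have a1 := hcon (r + s) ih
          have a2 := lam.antitone (r + s)
          rw [← add_assoc]; omega
      have : (Set.univ : Set ℕ).Finite := by
        apply Set.Finite.of_finite_image (f := fun s => r + s)
        · apply lam.parts.support.finite_toSet.subset
          rintro _ ⟨s, _, rfl⟩
          simp only [Finset.mem_coe, Finsupp.mem_support_iff, hall s]; omega
        · intro a _ b _ hab; simpa using hab
      exact Set.infinite_univ this
    have hnext : lam.parts (r + 1) = p - 1 := by
      by_contra hne
      obtain ⟨nu, hnu⟩ := aux_update lam r (p - 1) (by omega) (by
        intro s hs'; have := lam.antitone s; rw [hs'] at this; omega)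
      refine hunex (r, p) ⟨⟨by simp; omega, by simp; omega⟩, nu, ?_, ?_, ?_, ?_⟩
      · intro s
        rw [hnu s, hnu (s + 1)]
        have h1 := hs s
        by_cases e1 : s = r
        · subst e1; simp; omega
        · by_cases e2 : s + 1 = r
          · have := lam.antitone s
            rw [e2] at this
            simp [e1, e2]; omega
          · simpa [e1, e2] using h1
      · rintro ⟨s, c⟩ ⟨h1, h2⟩
        refine ⟨h1, ?_⟩
        simp only [hnu] at h2 ⊢
        split_ifs at h2 with e
        · subst e; omega
        · exact h2
      · simp [diagram, hnu]; omega
      · rintro ⟨s, c⟩ ⟨h1, h2⟩ h3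
        simp only [diagram, Set.mem_setOf_eq, hnu] at h1 h2 h3
        split_ifs at h3 with e
        · subst e
          have : c = p := by omega
          subst this; exact r0
        · exact absurd ⟨h1, h2⟩ h3
    refine ⟨r + 1, ?_⟩
    have hA : (r + 1, p) ∈ diagram mu := by
      apply hm2; right
      obtain ⟨nu, hnu⟩ := aux_update lam (r + 1) p (by have := lam.antitone (r+1); omega) (by
        intro s hs'; have : s = r := by omega
        subst this; omega)
      refine ⟨r0, ?_, nu, ?_, ?_, ?_, ?_⟩
      · simp [diagram]; omega
      · intro s
        rw [hnu s, hnu (s + 1)]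
        have h1 := hs s
        by_cases e1 : s = r
        · subst e1; simp; right; left; rw [hr]; exact ⟨by omega, hdvd⟩
        · by_cases e2 : s = r + 1
          · have := lam.antitone s
            rw [e2] at this
            simp [e2]; omega
          · simpa [e1, e2] using h1
      · rintro ⟨s, c⟩ ⟨h1, h2⟩
        refine ⟨h1, ?_⟩
        simp only [hnu] at h2 ⊢
        split_ifs with e
        · subst e; omega
        · exact h2
      · simp [diagram, hnu]; omega
      · rintro ⟨s, c⟩ ⟨h1, h2⟩ h3
        simp only [diagram, Set.mem_setOf_eq, hnu] at h1 h2 h3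
        split_ifs at h2 with e
        · subst e
          have : c = p := by omega
          subst this; exact r0
        · exact absurd ⟨h1, h2⟩ h3
    have hB : (r + 1, p + 1) ∉ diagram mu := by
      intro hin
      obtain ⟨_, _, nu, hns, hsub, hx, hall⟩ := hm1 _ hin (by simp [diagram]; omega)
      simp only [diagram, Set.mem_setOf_eq] at hx
      have h3 : p + 2 ≤ nu.parts r := by
        have a1 := nu.antitone r
        rcases hns r with h' | ⟨h', h''⟩ | h'
        · omega
        · by_contra hlt
          have : nu.parts r = p + 1 := by omega
          rw [this] at h''
          exact hndp h''
        · omega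
      exact r2 (hall (r, p + 2) ⟨by simp, h3⟩ (by simp [diagram]; omega))
    simp only [diagram, Set.mem_setOf_eq] at hA hB
    omega
  · rintro ⟨r, hr⟩
    by_contra hno
    push Not at hno
    have hle : lam.parts r ≤ p := by
      by_contra hgt
      have := hm2 (r, p + 1) (Or.inl ⟨by simp, by simp; omega⟩)
      simp only [diagram, Set.mem_setOf_eq] at this
      omega
    have hne := hno r
    have hpm : lam.parts r = p - 1 := by
      by_contra hlt
      have := hm1 (r, p - 1) ⟨by simp; omega, by simp; omega⟩ (by simp [diagram]; omega)
      exact rm this.1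
    have hnp1 : ∀ s, lam.parts s ≠ p + 1 := by
      intro t ht
      have ht1 : lam.parts (t + 1) ≤ p := by
        rcases hs t with h' | ⟨h', h''⟩ | h'
        · omega
        · rw [ht] at h''; exact absurd h'' hndp
        · omega
      obtain ⟨nu, hnu⟩ := aux_update lam t p ht1 (by
        intro s hs'; have := lam.antitone s; rw [hs'] at this; omega)
      refine hunex (t, p + 1) ⟨⟨by simp, by simp; omega⟩, nu, ?_, ?_, ?_, ?_⟩
      · intro s
        rw [hnu s, hnu (s + 1)]
        have h1 := hs s
        by_cases e1 : s = t
        · subst e1; simp; right; left; exact ⟨by omega, hdvd⟩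
        · by_cases e2 : s + 1 = t
          · have := lam.antitone s
            rw [e2] at this
            simp [e1, e2]; omega
          · simpa [e1, e2] using h1
      · rintro ⟨s, c⟩ ⟨h1, h2⟩
        refine ⟨h1, ?_⟩
        simp only [hnu] at h2 ⊢
        split_ifs at h2 with e
        · subst e; omega
        · exact h2
      · simp [diagram, hnu]
      · rintro ⟨s, c⟩ ⟨h1, h2⟩ h3
        simp only [diagram, Set.mem_setOf_eq, hnu] at h1 h2 h3
        split_ifs at h3 with e
        · subst e
          have : c = p + 1 := by omega
          subst this; exact r1
        · exact absurd ⟨h1, h2⟩ h3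
    have hprev : ∀ s, s + 1 = r → p + 2 ≤ lam.parts s := by
      intro s hs'
      have a0 := lam.antitone s
      rw [hs'] at a0
      have a1 := hno s
      have a2 := hnp1 s
      rcases hs s with h' | ⟨h', h''⟩ | h'
      · rw [hs'] at h'; omega
      · by_contra hlt
        have : lam.parts s = p - 1 := by omega
        rw [this] at h''
        exact hndm h''
      · omega
    have hA : (r, p + 1) ∈ diagram mu := by
      apply hm2; right
      obtain ⟨nu, hnu⟩ := aux_update lam r (p + 1) (by have := lam.antitone r; omega) (by
        intro s hs'; have := hprev s hs'; omega)
      refine ⟨r1, ?_, nu, ?_, ?_, ?_, ?_⟩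
      · simp [diagram]; omega
      · intro s
        rw [hnu s, hnu (s + 1)]
        have h1 := hs s
        by_cases e1 : s = r
        · subst e1; have := lam.antitone s; simp; omega
        · by_cases e2 : s + 1 = r
          · have := hprev s e2
            simp [e1, e2]; omega
          · simpa [e1, e2] using h1
      · rintro ⟨s, c⟩ ⟨h1, h2⟩
        refine ⟨h1, ?_⟩
        simp only [hnu] at h2 ⊢
        split_ifs with e
        · subst e; omega
        · exact h2
      · simp [diagram, hnu]
      · rintro ⟨s, c⟩ ⟨h1, h2⟩ h3
        simp only [diagram, Set.mem_setOf_eq, hnu] at h1 h2 h3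
        split_ifs at h2 with e
        · subst e
          have : c = p ∨ c = p + 1 := by omega
          rcases this with rfl | rfl
          · exact r0
          · exact r1
        · exact absurd ⟨h1, h2⟩ h3
    simp only [diagram, Set.mem_setOf_eq] at hA
    omega

end BPartition

open BPartition in
/-- In a [2:k]-pair (P_{σ,2}, P_{τ,2}) of residue i with i ≥ 1 or k ≥ 3, an
unexceptional λ ∈ P_{σ,2} has a part equal to h or 2h iff ψ_i(λ) does. -/
theorem stmt16 (n h : ℕ) (hn : 1 ≤ n) (hh : h = 2 * n + 1) (i k : ℕ) (hi : i ≤ n)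
    (hk : 1 ≤ k) (σ : BPartition) (hσ : IsBarCore h σ)
    (hcnt : Set.ncard {x : ℕ × ℕ | Addable h i σ x} = k)
    (τ : BPartition) (hτ : τ = psi h i σ) (hik : 1 ≤ i ∨ 3 ≤ k)
    (lam : BPartition) (h1 : InBlock h σ 2 lam)
    (hunex : ∀ x, ¬ Removable h i lam x) :
    (h ∈ partsM lam ∨ 2 * h ∈ partsM lam) ↔
      (h ∈ partsM (psi h i lam) ∨ 2 * h ∈ partsM (psi h i lam)) := by
  have h3 : 3 ≤ h := by omega
  rw [aux_mem_partsM _ _ (by omega : 0 < h), aux_mem_partsM _ _ (by omega : 0 < 2 * h),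
    aux_mem_partsM _ _ (by omega : 0 < h), aux_mem_partsM _ _ (by omega : 0 < 2 * h)]
  by_cases hex : ∃ mu : BPartition, diagram mu = psiSet h i lam
  swap
  · rw [psi, dif_neg hex]
  have hmu : diagram (psi h i lam) = psiSet h i lam := by
    rw [psi, dif_pos hex]; exact hex.choose_spec
  generalize psi h i lam = mu at hmu
  have hN : {x | Normal h i lam x} = ∅ := by
    ext x; simp only [Set.mem_setOf_eq, Set.mem_empty_iff_false, iff_false]
    exact fun hx => hunex x hx.1
  rw [psiSet, if_pos (by rw [hN]; simp)] at hmu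
  have hm1 : ∀ x, x ∈ diagram mu → x ∉ diagram lam → Addable h i lam x := by
    intro x hx hx'
    rw [hmu] at hx
    rcases hx with hx | hx
    · exact absurd hx hx'
    · exact hx.1.1
  rcases Nat.eq_zero_or_pos i with hi0 | hi0
  · subst hi0
    have hfin := aux_finite h3 lam
    have hm2 : ∀ x, x ∈ diagram lam ∨ Addable h 0 lam x → x ∈ diagram mu := by
      intro x hx
      rw [hmu]
      rcases hx with hx | hx
      · exact Or.inl hx
      right
      refine ⟨⟨hx, fun z hz => ?_⟩, ?_⟩
      · have e : {y | Removable h 0 lam y ∧ posLE x y ∧ posLE y z} = ∅ := by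
          ext y; simp only [Set.mem_setOf_eq, Set.mem_empty_iff_false, iff_false]
          exact fun hy => hunex y hy.1
        rw [e, Set.ncard_empty, Set.ncard_pos (hfin.subset fun y hy => hy.1)]
        exact ⟨x, hx, Or.inr ⟨rfl, le_rfl⟩, hz⟩
      · rw [hN, Set.ncard_empty, Nat.sub_zero]
        exact Set.ncard_le_ncard (fun y hy => hy.1) (hfin.subset fun y hy => hy.1)
    have m1 := aux_main h3 lam mu h1.1 hunex hm1 hm2 1 le_rfl
    have m2 := aux_main h3 lam mu h1.1 hunex hm1 hm2 2 (by omega)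
    rw [one_mul] at m1
    rw [m1, m2]
  · have key : ∀ j, 1 ≤ j → ∀ r, lam.parts r = j * h ↔ mu.parts r = j * h := by
      intro j hj r
      have r0 := aux_res0 (h := h) j
      have r1 := aux_res1 (h := h) j
      have hp : 1 ≤ j * h := by nlinarith
      have hsub : ∀ c, 1 ≤ c → c ≤ lam.parts r → c ≤ mu.parts r := by
        intro c hc hc'
        have : (r, c) ∈ diagram mu := by rw [hmu]; exact Or.inl ⟨hc, hc'⟩
        exact this.2
      have hsup : ∀ c, 1 ≤ c → colRes h c = 0 → c ≤ mu.parts r → c ≤ lam.parts r := by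
        intro c hc hr hc'
        by_contra hlt
        have := (hm1 (r, c) ⟨hc, hc'⟩ (fun hx => hlt hx.2)).1
        simp only at this
        omega
      have a1 := hsub (j * h) hp
      have a2 := hsub (j * h + 1) (by omega)
      have a3 := hsup (j * h) hp r0
      have a4 := hsup (j * h + 1) (by omega) r1
      omega
    have k1 := key 1 le_rfl
    have k2 := key 2 (by omega)
    rw [one_mul] at k1
    simp only [k1, k2]
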